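/- Let (X,d) be a metric space with basepoint x₀ containing a sequence of distinct points x₁, x₂, … with xᵢ ≠ x₀ and Σᵢ d(x₀,xᵢ) < 1. Then the set L = {(ε, x₁x₂⋯xᵢ) : i ∈ ℕ} ⊆ ∗X × ∗X belongs to the bounded coarse structure 𝓑_{d*} of the free-product metric d*, but L does not belong to the coarse free product structure ∗𝓑_d; in particular the inclusion ∗𝓑_d ⊆ 𝓑_{d*} is strict. -/

import Mathlib

open Set

universe u v

/-- Composition of two relations. -/
def rcomp {X : Type u} (E F : Set (X × X)) : Set (X × X) :=
  {p | ∃ y, (p.1, y) ∈ E ∧ (y, p.2) ∈ F}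

/-- A collection of subsets of `X × X` is a coarse structure if it contains the diagonal and
is closed under inverses, finite unions, subsets and compositions. -/
def IsCoarseStructure {X : Type u} (𝓔 : Set (Set (X × X))) : Prop :=
  {p : X × X | p.1 = p.2} ∈ 𝓔 ∧
    (∀ E ∈ 𝓔, Prod.swap '' E ∈ 𝓔) ∧
    (∀ E ∈ 𝓔, ∀ F ∈ 𝓔, E ∪ F ∈ 𝓔) ∧
    (∀ E ∈ 𝓔, ∀ F, F ⊆ E → F ∈ 𝓔) ∧
    (∀ E ∈ 𝓔, ∀ F ∈ 𝓔, rcomp E F ∈ 𝓔)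

/-- `compIter E k` is the `k`-fold composition `E ∘ E ∘ ⋯ ∘ E`, with `E^0 = E ∩ Δ`. -/
def compIter {X : Type u} (E : Set (X × X)) : ℕ → Set (X × X)
  | 0 => E ∩ {p | p.1 = p.2}
  | 1 => E
  | k + 2 => rcomp E (compIter E (k + 1))

/-- `DE E x y = min {k : (x,y) ∈ E^k}`, with value `∞` if there is no such `k`. -/
noncomputable def DE {X : Type u} (E : Set (X × X)) (x y : X) : ℕ∞ :=
  sInf {n : ℕ∞ | ∃ k : ℕ, n = (k : ℕ∞) ∧ (x, y) ∈ compIter E k}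

/-- The free product `∗X`: finite words in the alphabet `X \ {x₀}`. -/
def FreeWord (X : Type u) (x₀ : X) : Type u := {l : List X // x₀ ∉ l}

/-- Concatenation of words. -/
def FreeWord.concat {X : Type u} {x₀ : X} (x y : FreeWord X x₀) : FreeWord X x₀ :=
  ⟨x.1 ++ y.1, fun h => (List.mem_append.mp h).elim x.2 y.2⟩

/-- The order (length) of a word. -/
def FreeWord.ord {X : Type u} {x₀ : X} (x : FreeWord X x₀) : ℕ := x.1.length

/-- The empty word `ε`. -/
def FreeWord.epsilon (X : Type u) (x₀ : X) : FreeWord X x₀ := ⟨[], by simp⟩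

/-- The one-letter word on a letter `u ≠ x₀`. -/
def FreeWord.single {X : Type u} {x₀ : X} (u : X) (h : u ≠ x₀) : FreeWord X x₀ :=
  ⟨[u], by simp only [List.mem_singleton]; exact fun hh => h hh.symm⟩

/-- `‖x₁⋯x_k‖_E = Σᵢ D_E(x₀, xᵢ)`. -/
noncomputable def wnormL {X : Type u} (E : Set (X × X)) (x₀ : X) (l : List X) : ℕ∞ :=
  (l.map fun a => DE E x₀ a).sum

/-- `‖x₁⋯x_k‖^E = Σᵢ D_E(xᵢ, x₀)`. -/
noncomputable def wnormR {X : Type u} (E : Set (X × X)) (x₀ : X) (l : List X) : ℕ∞ :=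
  (l.map fun a => DE E a x₀).sum

open Classical in
/-- `D*_E` on underlying lists: equal words are at distance `0`; otherwise strip the longest
common prefix `a`, at the first difference `x = a·b·c`, `x' = a·b'·c'` (with `b = x₀` and `c = ε`
when a word has run out) the value is `D_E(b,b') + ‖c‖_E + ‖c'‖^E`. -/
noncomputable def DstarList {X : Type u} (E : Set (X × X)) (x₀ : X) :
    List X → List X → ℕ∞
  | [], [] => 0
  | [], b :: t => DE E x₀ b + wnormR E x₀ t
  | a :: s, [] => DE E a x₀ + wnormL E x₀ s
  | a :: s, b :: t =>
      if a = b then DstarList E x₀ s t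
      else DE E a b + wnormL E x₀ s + wnormR E x₀ t

/-- `D*_E` on the free product `∗X`. -/
noncomputable def Dstar {X : Type u} (E : Set (X × X)) (x₀ : X)
    (x y : FreeWord X x₀) : ℕ∞ :=
  DstarList E x₀ x.1 y.1

/-- `⟨E,n⟩ = {(x,x') : D*_E(x,x') ≤ n}`. -/
def bracket {X : Type u} (E : Set (X × X)) (x₀ : X) (n : ℕ) :
    Set (FreeWord X x₀ × FreeWord X x₀) :=
  {p | Dstar E x₀ p.1 p.2 ≤ (n : ℕ∞)}

/-- The coarse free product structure `∗𝓔`: the subset closure of the sets `⟨E,n⟩`. -/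
def freeEnts {X : Type u} (𝓔 : Set (Set (X × X))) (x₀ : X) :
    Set (Set (FreeWord X x₀ × FreeWord X x₀)) :=
  {L | ∃ E ∈ 𝓔, ∃ n : ℕ, L ⊆ bracket E x₀ n}

/-- A family of subsets is `E`-disjoint if products of distinct members miss `E`. -/
def EDisjointFam {Y : Type v} (𝒰 : Set (Set Y)) (E : Set (Y × Y)) : Prop :=
  ∀ U ∈ 𝒰, ∀ V ∈ 𝒰, U ≠ V → ∀ u ∈ U, ∀ v ∈ V, (u, v) ∉ E

/-- A family of subsets is `K`-bounded if `∪ U × U ⊆ K`. -/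
def KBoundedFam {Y : Type v} (𝒰 : Set (Set Y)) (K : Set (Y × Y)) : Prop :=
  ∀ U ∈ 𝒰, ∀ u ∈ U, ∀ v ∈ U, (u, v) ∈ K

/-- Asymptotic dimension at most `n` of a space with entourage collection `ents`. -/
def AsdimLE {Y : Type v} (ents : Set (Set (Y × Y))) (n : ℕ) : Prop :=
  ∀ E ∈ ents, ∃ K ∈ ents, ∃ 𝒰 : Fin (n + 1) → Set (Set Y),
    (∀ y : Y, ∃ i, ∃ V ∈ 𝒰 i, y ∈ V) ∧
    (∀ i, EDisjointFam (𝒰 i) E) ∧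
    (∀ i, KBoundedFam (𝒰 i) K)

/-- The subspace coarse structure on `A ⊆ Y`. -/
def subEnts {Y : Type v} (ents : Set (Set (Y × Y))) (A : Set Y) :
    Set (Set (↥A × ↥A)) :=
  {L | (Prod.map ((↑) : A → Y) ((↑) : A → Y)) '' L ∈ ents}

/-- Entourages of the total space `T({U_i}; J) = ⊔ᵢ Uᵢ` of a family of subsets. -/
def totalEnts {Y : Type v} {J : Type*} (ents : Set (Set (Y × Y))) (U : J → Set Y) :
    Set (Set ((Σ i : J, ↥(U i)) × (Σ i : J, ↥(U i)))) :=
  {L | ∃ E ∈ ents, ∀ p ∈ L, p.1.1 = p.2.1 ∧ ((p.1.2 : Y), (p.2.2 : Y)) ∈ E}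

/-- A family `{U_i}` has asymptotic dimension at most `m` uniformly if its total space does. -/
def UniformAsdimLE {Y : Type v} {J : Type*} (ents : Set (Set (Y × Y)))
    (U : J → Set Y) (m : ℕ) : Prop :=
  AsdimLE (totalEnts ents U) m

/-- The symmetric ball `B(x₀, E)`. -/
def symmBall {X : Type u} (E : Set (X × X)) (x₀ : X) : Set X :=
  {y | (x₀, y) ∈ E ∨ (y, x₀) ∈ E}

/-- The `M`-cone `con_M(A) = A · (∗B(x₀,M))`. -/
def cone {X : Type u} (M : Set (X × X)) (x₀ : X) (A : Set (FreeWord X x₀)) :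
    Set (FreeWord X x₀) :=
  {z | ∃ a ∈ A, ∃ w : FreeWord X x₀, (∀ c ∈ w.1, c ∈ symmBall M x₀) ∧ z = a.concat w}

/-- The bounded coarse structure of a metric space: subsets of `X × X` on which the
distance is bounded. -/
def metricBoundedCoarse (X : Type u) [PseudoMetricSpace X] : Set (Set (X × X)) :=
  {E | ∃ R : ℝ, ∀ p ∈ E, dist p.1 p.2 ≤ R}

open Classical in
/-- The free-product metric `d*` on underlying lists:
`d*(a·b·x₁⋯x_n, a·b'·x'₁⋯x'_m) = d(b,b') + Σ d(xᵢ,x₀) + Σ d(x'ⱼ,x₀)`. -/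
noncomputable def dstarList {X : Type u} [PseudoMetricSpace X] (x₀ : X) :
    List X → List X → ℝ
  | [], [] => 0
  | [], b :: t => dist x₀ b + (t.map fun c => dist c x₀).sum
  | a :: s, [] => dist a x₀ + (s.map fun c => dist c x₀).sum
  | a :: s, b :: t =>
      if a = b then dstarList x₀ s t
      else dist a b + (s.map fun c => dist c x₀).sum + (t.map fun c => dist c x₀).sum

/-- The free-product metric `d*` on `∗X`. -/
noncomputable def dstar {X : Type u} [PseudoMetricSpace X] (x₀ : X)
    (x y : FreeWord X x₀) : ℝ :=
  dstarList x₀ x.1 y.1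

/-- The bounded coarse structure `𝓑_{d*}` on `∗X` associated to the free-product
metric `d*`. -/
def metricFreeBounded (X : Type u) [PseudoMetricSpace X] (x₀ : X) :
    Set (Set (FreeWord X x₀ × FreeWord X x₀)) :=
  {E | ∃ R : ℝ, ∀ p ∈ E, dstar x₀ p.1 p.2 ≤ R}

/-- The word `x₁x₂⋯xᵢ` built from the first `i` terms of a sequence avoiding `x₀`. -/
def initialWord {X : Type u} (x₀ : X) (x : ℕ → X) (hne : ∀ i, x i ≠ x₀) (i : ℕ) :
    FreeWord X x₀ :=
  ⟨(List.range i).map x, by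
    intro h
    obtain ⟨j, -, hj⟩ := List.mem_map.mp h
    exact hne j hj⟩

theorem DE_le_imp_mem_compIter {X : Type u} {E : Set (X × X)} {a b : X} {n : ℕ}
    (h : DE E a b ≤ n) : ∃ k ≤ n, (a, b) ∈ compIter E k := by
  have hne : {m : ℕ∞ | ∃ k : ℕ, m = (k : ℕ∞) ∧ (a, b) ∈ compIter E k}.Nonempty := by
    by_contra hemp
    rw [Set.not_nonempty_iff_eq_empty] at hemp
    rw [DE, hemp, sInf_empty] at h
    exact ENat.natCast_ne_top n (top_le_iff.mp h)
  obtain ⟨k, hk, hmem⟩ := csInf_mem hne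
  refine ⟨k, ?_, hmem⟩
  have hle : (k : ℕ∞) ≤ n := hk ▸ h
  exact_mod_cast hle

theorem one_le_DE {X : Type u} (E : Set (X × X)) {a b : X} (hab : a ≠ b) : 1 ≤ DE E a b := by
  refine le_sInf ?_
  rintro _ ⟨k, rfl, hk⟩
  rcases k with _ | k
  · exact absurd hk.2 hab
  · exact_mod_cast Nat.succ_le_succ (Nat.zero_le k)

theorem length_le_wnormR {X : Type u} (E : Set (X × X)) {x₀ : X} {l : List X} (hl : x₀ ∉ l) :
    (l.length : ℕ∞) ≤ wnormR E x₀ l := by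
  induction l with
  | nil => simp
  | cons a t ih =>
    rw [List.mem_cons, not_or] at hl
    simp only [wnormR, List.map_cons, List.sum_cons, List.length_cons] at ih ⊢
    push_cast
    rw [add_comm]
    exact add_le_add (one_le_DE E (Ne.symm hl.1)) (ih hl.2)

theorem length_le_DstarList_nil {X : Type u} (E : Set (X × X)) {x₀ : X} {l : List X}
    (hl : x₀ ∉ l) : (l.length : ℕ∞) ≤ DstarList E x₀ [] l := by
  cases l with
  | nil => simp
  | cons a t =>
    rw [List.mem_cons, not_or] at hl
    simp only [DstarList, List.length_cons]
    push_cast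
    rw [add_comm]
    exact add_le_add (one_le_DE E hl.1) (length_le_wnormR E hl.2)

theorem exists_nat_add_of_add_le {a b : ℕ∞} {n : ℕ} (h : a + b ≤ n) :
    ∃ i j : ℕ, a ≤ i ∧ b ≤ j ∧ i + j ≤ n := by
  have ha : a ≠ ⊤ := ne_top_of_le_ne_top (ENat.natCast_ne_top n) (le_self_add.trans h)
  have hb : b ≠ ⊤ := ne_top_of_le_ne_top (ENat.natCast_ne_top n) (le_add_self.trans h)
  lift a to ℕ using ha
  lift b to ℕ using hb
  exact ⟨a, b, le_rfl, le_rfl, by exact_mod_cast h⟩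

section BoundedRelation

variable {X : Type u} [PseudoMetricSpace X] {E : Set (X × X)} {R : ℝ}

theorem dist_le_mul_of_mem_compIter (hE : ∀ p ∈ E, dist p.1 p.2 ≤ R) (k : ℕ) {a b : X}
    (h : (a, b) ∈ compIter E k) : dist a b ≤ k * R := by
  induction k using Nat.twoStepInduction generalizing a with
  | zero =>
    have hab : a = b := h.2
    simp [hab]
  | one => simpa using hE _ h
  | more k _ ih =>
    obtain ⟨y, hy, hyb⟩ := h
    have h₁ : dist a y ≤ R := hE _ hy
    have h₂ := ih hyb
    have h₃ := dist_triangle a y b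
    push_cast at h₂ ⊢
    linarith

theorem dist_le_mul_of_DE_le (hR : 0 ≤ R) (hE : ∀ p ∈ E, dist p.1 p.2 ≤ R) {a b : X} {n : ℕ}
    (h : DE E a b ≤ n) : dist a b ≤ n * R := by
  obtain ⟨k, hk, hmem⟩ := DE_le_imp_mem_compIter h
  refine (dist_le_mul_of_mem_compIter hE k hmem).trans ?_
  gcongr

theorem le_mul_of_add_le (hR : 0 ≤ R) {a b : ℕ∞} {r s : ℝ}
    (ha : ∀ i : ℕ, a ≤ i → r ≤ i * R) (hb : ∀ j : ℕ, b ≤ j → s ≤ j * R)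
    {n : ℕ} (h : a + b ≤ n) : r + s ≤ n * R := by
  obtain ⟨i, j, hi, hj, hij⟩ := exists_nat_add_of_add_le h
  calc r + s ≤ i * R + j * R := add_le_add (ha i hi) (hb j hj)
    _ = ((i + j : ℕ) : ℝ) * R := by push_cast; ring
    _ ≤ n * R := by gcongr

theorem sum_dist_le_mul_of_wnormR_le (hR : 0 ≤ R) (hE : ∀ p ∈ E, dist p.1 p.2 ≤ R) {x₀ : X}
    (l : List X) (n : ℕ) (h : wnormR E x₀ l ≤ n) :
    (l.map fun c => dist c x₀).sum ≤ n * R := by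
  induction l generalizing n with
  | nil => simpa using mul_nonneg n.cast_nonneg hR
  | cons a t ih =>
    simp only [wnormR, List.map_cons, List.sum_cons] at h ⊢
    exact le_mul_of_add_le hR (fun _ hi => dist_le_mul_of_DE_le hR hE hi) ih h

theorem sum_dist_le_mul_of_wnormL_le (hR : 0 ≤ R) (hE : ∀ p ∈ E, dist p.1 p.2 ≤ R) {x₀ : X}
    (l : List X) (n : ℕ) (h : wnormL E x₀ l ≤ n) :
    (l.map fun c => dist c x₀).sum ≤ n * R := by
  induction l generalizing n with
  | nil => simpa using mul_nonneg n.cast_nonneg hR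
  | cons a t ih =>
    simp only [wnormL, List.map_cons, List.sum_cons] at h ⊢
    refine le_mul_of_add_le hR (fun _ hi => ?_) ih h
    rw [dist_comm]
    exact dist_le_mul_of_DE_le hR hE hi

theorem dstarList_le_mul_of_DstarList_le (hR : 0 ≤ R) (hE : ∀ p ∈ E, dist p.1 p.2 ≤ R) {x₀ : X}
    (l l' : List X) (n : ℕ) (h : DstarList E x₀ l l' ≤ n) : dstarList x₀ l l' ≤ n * R := by
  have hDE : ∀ (a b : X) (i : ℕ), DE E a b ≤ i → dist a b ≤ i * R :=
    fun _ _ _ => dist_le_mul_of_DE_le hR hE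
  have hL := sum_dist_le_mul_of_wnormL_le hR hE (x₀ := x₀)
  have hR' := sum_dist_le_mul_of_wnormR_le hR hE (x₀ := x₀)
  induction l generalizing l' with
  | nil =>
    cases l' with
    | nil => simpa [dstarList] using mul_nonneg n.cast_nonneg hR
    | cons b t =>
      simp only [DstarList, dstarList] at h ⊢
      exact le_mul_of_add_le hR (hDE _ _) (hR' _) h
  | cons a s ih =>
    cases l' with
    | nil =>
      simp only [DstarList, dstarList] at h ⊢
      exact le_mul_of_add_le hR (hDE _ _) (hL _) h
    | cons b t =>
      simp only [DstarList, dstarList] at h ⊢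
      split_ifs at h ⊢
      · exact ih t h
      · exact le_mul_of_add_le hR
          (fun _ hi => le_mul_of_add_le hR (hDE _ _) (hL _) hi) (hR' _) h

end BoundedRelation

theorem freeEnts_metricBoundedCoarse_subset {X : Type u} [PseudoMetricSpace X] (x₀ : X) :
    freeEnts (metricBoundedCoarse X) x₀ ⊆ metricFreeBounded X x₀ := by
  rintro L ⟨E, ⟨R, hE⟩, n, hL⟩
  exact ⟨n * max R 0, fun p hp => dstarList_le_mul_of_DstarList_le (le_max_right R 0)
    (fun q hq => (hE q hq).trans (le_max_left R 0)) _ _ n (hL hp)⟩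

theorem dstarList_nil_left {X : Type u} [PseudoMetricSpace X] (x₀ : X) (l : List X) :
    dstarList x₀ [] l = (l.map fun c => dist x₀ c).sum := by
  cases l with
  | nil => simp [dstarList]
  | cons b t => simp only [dstarList, List.map_cons, List.sum_cons, dist_comm]

/-- If `X` contains a sequence of distinct points `xᵢ ≠ x₀` with `Σᵢ d(x₀,xᵢ) < 1`, then
`L = {(ε, x₁⋯xᵢ) : i}` lies in `𝓑_{d*}` but not in `∗𝓑_d`; in particular the inclusion
`∗𝓑_d ⊆ 𝓑_{d*}` is strict. -/
theorem free_product_coarse_structure_strict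
    {X : Type u} [MetricSpace X] (x₀ : X) (x : ℕ → X)
    (hinj : Function.Injective x) (hne : ∀ i, x i ≠ x₀)
    (hsum : Summable fun i => dist x₀ (x i))
    (hlt : (∑' i, dist x₀ (x i)) < 1) :
    {p : FreeWord X x₀ × FreeWord X x₀ |
        ∃ i : ℕ, p = (FreeWord.epsilon X x₀, initialWord x₀ x hne (i + 1))}
      ∈ metricFreeBounded X x₀ ∧
    {p : FreeWord X x₀ × FreeWord X x₀ |
        ∃ i : ℕ, p = (FreeWord.epsilon X x₀, initialWord x₀ x hne (i + 1))}
      ∉ freeEnts (metricBoundedCoarse X) x₀ ∧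
    freeEnts (metricBoundedCoarse X) x₀ ⊂ metricFreeBounded X x₀ := by
  have hmem : {p : FreeWord X x₀ × FreeWord X x₀ |
      ∃ i : ℕ, p = (FreeWord.epsilon X x₀, initialWord x₀ x hne (i + 1))}
      ∈ metricFreeBounded X x₀ := by
    refine ⟨1, ?_⟩
    rintro _ ⟨i, rfl⟩
    have heq : dstar x₀ (FreeWord.epsilon X x₀) (initialWord x₀ x hne (i + 1)) =
        ∑ j ∈ Finset.range (i + 1), dist x₀ (x j) := by
      simp only [dstar, FreeWord.epsilon, initialWord]
      rw [dstarList_nil_left, List.map_map]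
      rfl
    rw [heq]
    exact (hsum.sum_le_tsum _ fun _ _ => dist_nonneg).trans hlt.le
  have hnot : {p : FreeWord X x₀ × FreeWord X x₀ |
      ∃ i : ℕ, p = (FreeWord.epsilon X x₀, initialWord x₀ x hne (i + 1))}
      ∉ freeEnts (metricBoundedCoarse X) x₀ := by
    rintro ⟨E, -, n, hL⟩
    have h₁ : DstarList E x₀ [] (initialWord x₀ x hne (n + 1)).1 ≤ n := hL ⟨n, rfl⟩
    have h₂ := (length_le_DstarList_nil E (initialWord x₀ x hne (n + 1)).2).trans h₁
    have h₃ : (initialWord x₀ x hne (n + 1)).1.length ≤ n := by exact_mod_cast h₂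
    simp [initialWord] at h₃
  exact ⟨hmem, hnot, freeEnts_metricBoundedCoarse_subset x₀, fun h => hnot (h hmem)⟩
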